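/- The mixed volume of n relative polyhedra compatible with an ambient cone C, defined as the unique symmetric multilinear function MV on relative polyhedra with MV((A,B),...,(A,B)) = Vol(A,B), exists and is unique. -/

import Mathlib

open scoped Pointwise BigOperators
open MeasureTheory

/-- `A` is a (bounded) lattice polytope. -/
def IsLatticePolytope {n : ℕ} (A : Set (Fin n → ℝ)) : Prop :=
  ∃ V : Set (Fin n → ℝ), V.Finite ∧ V.Nonempty ∧
    (∀ x ∈ V, ∀ i, ∃ m : ℤ, x i = (m : ℝ)) ∧ A = convexHull ℝ V

/-- `p = (A,B)` is a relative polyhedron compatible with the cone whose polar is `C`: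
both components are of the form (bounded lattice polytope) + `C`, and the symmetric
difference of the components is bounded. -/
def IsRelPoly {n : ℕ} (C : Set (Fin n → ℝ))
    (p : Set (Fin n → ℝ) × Set (Fin n → ℝ)) : Prop :=
  (∃ A, IsLatticePolytope A ∧ p.1 = A + C) ∧
  (∃ B, IsLatticePolytope B ∧ p.2 = B + C) ∧
  Bornology.IsBounded ((p.1 \ p.2) ∪ (p.2 \ p.1))

/-- The relative (lattice-normalized) volume of a relative polyhedron. -/
noncomputable def relVol (n : ℕ) (p : Set (Fin n → ℝ) × Set (Fin n → ℝ)) : ℝ :=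
  (n.factorial : ℝ) * ((volume (p.1 \ p.2)).toReal - (volume (p.2 \ p.1)).toReal)

/-- Componentwise Minkowski sum of relative polyhedra. -/
def addPair {n : ℕ} (p q : Set (Fin n → ℝ) × Set (Fin n → ℝ)) :
    Set (Fin n → ℝ) × Set (Fin n → ℝ) :=
  (p.1 + q.1, p.2 + q.2)

/-- `MV` is a symmetric, Minkowski-multilinear function on relative polyhedra in `n`
arguments whose diagonal values are the relative volume. -/
def IsMixedVolume (n : ℕ) (C : Set (Fin n → ℝ))
    (MV : (Fin n → Set (Fin n → ℝ) × Set (Fin n → ℝ)) → ℝ) : Prop :=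
  (∀ v (σ : Equiv.Perm (Fin n)), MV (v ∘ σ) = MV v) ∧
  (∀ (v : Fin n → Set (Fin n → ℝ) × Set (Fin n → ℝ)) (i : Fin n) p q,
    (∀ j, IsRelPoly C (v j)) → IsRelPoly C p → IsRelPoly C q →
      MV (Function.update v i (addPair p q)) =
        MV (Function.update v i p) + MV (Function.update v i q)) ∧
  (∀ p, IsRelPoly C p → MV (fun _ => p) = relVol n p)

theorem aux_altsum {ι : Type*} [Fintype ι] [DecidableEq ι] (R : Finset ι) :
    ∑ S : Finset ι, (if R ⊆ S then (-1 : ℝ) ^ S.card else 0) =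
      if R = Finset.univ then (-1 : ℝ) ^ Fintype.card ι else 0 := by
  split_ifs with h
  · subst h
    simp only [Finset.univ_subset_iff]
    rw [Finset.sum_ite_eq' Finset.univ Finset.univ]
    simp [Finset.card_univ]
  · obtain ⟨j, hj⟩ : ∃ j, j ∉ R := by
      by_contra! hc
      exact h (Finset.eq_univ_iff_forall.2 hc)
    have huniv : (Finset.univ : Finset (Finset ι)) =
        (insert j (Finset.univ.erase j)).powerset := by
      rw [Finset.insert_erase (Finset.mem_univ j), Finset.powerset_univ]
    rw [huniv, Finset.sum_powerset_insert (by simp), ← Finset.sum_add_distrib]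
    refine Finset.sum_eq_zero fun S hS => ?_
    have hjS : j ∉ S := fun hjS => by
      have := Finset.mem_powerset.1 hS hjS
      simp at this
    have : R ⊆ insert j S ↔ R ⊆ S := by
      constructor
      · intro hR x hx
        rcases Finset.mem_insert.1 (hR hx) with rfl | h'
        · exact absurd hx hj
        · exact h'
      · intro hR
        exact hR.trans (Finset.subset_insert _ _)
    rw [Finset.card_insert_of_notMem hjS]
    simp only [this]
    split_ifs <;> ring

theorem aux_polar {R M ι κ : Type*} [Semiring R] [AddCommMonoid M] [Module R M] [Module R ℝ]
    [Fintype ι] [DecidableEq ι] [Fintype κ] [DecidableEq κ]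
    (T : MultilinearMap R (fun _ : κ => M) ℝ) (a : ι → κ → M) :
    ∑ S : Finset ι, (-1 : ℝ) ^ S.card * T (fun r => ∑ i ∈ S, a i r) =
      ∑ f : κ → ι, if Finset.image f Finset.univ = Finset.univ then
        (-1 : ℝ) ^ Fintype.card ι * T (fun r => a (f r) r) else 0 := by
  have h1 : ∀ S : Finset ι, (-1 : ℝ) ^ S.card * T (fun r => ∑ i ∈ S, a i r) =
      ∑ f : κ → ι, (if Finset.image f Finset.univ ⊆ S then (-1 : ℝ) ^ S.card else 0) *
        T (fun r => a (f r) r) := by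
    intro S
    rw [T.map_sum_finset (fun r i => a i r) (fun _ => S), Finset.mul_sum]
    simp only [ite_mul, zero_mul]
    rw [← Finset.sum_filter]
    refine Finset.sum_congr ?_ fun _ _ => rfl
    ext f
    simp [Finset.image_subset_iff]
  simp only [h1]
  rw [Finset.sum_comm]
  refine Finset.sum_congr rfl fun f _ => ?_
  rw [← Finset.sum_mul, aux_altsum]
  split_ifs <;> simp

theorem aux_split {ι : Type*} [Fintype ι] [DecidableEq ι] (i : ι) (h : Finset ι → ℝ) :
    ∑ S : Finset ι, h S =
      ∑ S ∈ (Finset.univ.erase i).powerset, (h S + h (insert i S)) := by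
  have huniv : (Finset.univ : Finset (Finset ι)) =
      (insert i (Finset.univ.erase i)).powerset := by
    rw [Finset.insert_erase (Finset.mem_univ i), Finset.powerset_univ]
  rw [huniv, Finset.sum_powerset_insert (by simp), ← Finset.sum_add_distrib]

theorem aux_split_option {ι : Type*} [Fintype ι] [DecidableEq ι] (h : Finset (Option ι) → ℝ) :
    ∑ S : Finset (Option ι), h S =
      ∑ S : Finset ι, (h (S.map Function.Embedding.some) +
        h (insert none (S.map Function.Embedding.some))) := by
  rw [aux_split none]
  have : (Finset.univ.erase (none : Option ι)) = Finset.univ.map Function.Embedding.some := by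
    ext x
    cases x <;> simp
  rw [this, Finset.map_eq_image, ← Finset.powerset_univ]
  symm
  refine Finset.sum_nbij (fun S => S.map Function.Embedding.some) ?_ ?_ ?_ ?_
  · intro S _
    simp [Finset.mem_powerset, Finset.map_eq_image, Finset.image_subset_image]
  · intro S _ S' _ hh
    exact Finset.map_injective _ hh
  · intro S hS
    simp only [Finset.coe_powerset, Set.mem_preimage, Set.mem_powerset_iff, Finset.coe_subset] at hS
    obtain ⟨S', _, rfl⟩ := Finset.subset_image_iff.1 (by simpa using hS : S ⊆ Finset.image _ Finset.univ)
    exact ⟨S', by simp, by simp [Finset.map_eq_image]⟩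
  · intro S _
    rfl

/-- The polarization of a function on a commutative monoid. -/
noncomputable def auxPol {M : Type*} [AddCommMonoid M] (n : ℕ) (f : M → ℝ) (v : Fin n → M) : ℝ :=
  (-1) ^ n / (n.factorial : ℝ) * ∑ S : Finset (Fin n), (-1 : ℝ) ^ S.card * f (∑ i ∈ S, v i)

theorem auxPol_symm {M : Type*} [AddCommMonoid M] (n : ℕ) (f : M → ℝ) (v : Fin n → M)
    (σ : Equiv.Perm (Fin n)) : auxPol n f (v ∘ σ) = auxPol n f v := by
  unfold auxPol
  congr 1
  refine Fintype.sum_equiv (Equiv.finsetCongr σ) _ _ fun S => ?_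
  simp

theorem auxPol_add {M : Type*} [AddCommMonoid M] (n : ℕ) (f : M → ℝ)
    (hf : ∀ w : Option (Fin n) → M,
      ∑ S : Finset (Option (Fin n)), (-1 : ℝ) ^ S.card * f (∑ i ∈ S, w i) = 0)
    (v : Fin n → M) (i : Fin n) (p q : M) :
    auxPol n f (Function.update v i (p + q)) =
      auxPol n f (Function.update v i p) + auxPol n f (Function.update v i q) := by
  unfold auxPol
  rw [← mul_add]
  congr 1
  have h := hf (fun o => o.elim q (Function.update v i p))
  rw [aux_split_option] at h
  simp only [Finset.sum_map, Finset.card_map, Function.Embedding.some_apply, Option.elim,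
    Finset.mem_map, reduceCtorEq, and_false, exists_false, not_false_eq_true,
    Finset.card_insert_of_notMem, Finset.sum_insert] at h
  rw [aux_split i] at h
  simp only [aux_split i]
  rw [← Finset.sum_add_distrib, ← sub_eq_zero, ← Finset.sum_sub_distrib]
  rw [← neg_eq_zero, ← Finset.sum_neg_distrib, ← h]
  refine Finset.sum_congr rfl fun S hS => ?_
  have hiS : i ∉ S := fun hjS => by
    have := Finset.mem_powerset.1 hS hjS
    simp at this
  have e : ∀ x : M, ∑ j ∈ S, Function.update v i x j = ∑ j ∈ S, v j := by
    intro x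
    refine Finset.sum_congr rfl fun j hj => ?_
    rw [Function.update_of_ne]
    rintro rfl
    exact hiS hj
  rw [Finset.card_insert_of_notMem hiS]
  simp only [Finset.sum_insert hiS, e, Function.update_self]
  rw [show q + (p + ∑ j ∈ S, v j) = p + q + ∑ j ∈ S, v j by
    rw [add_comm p q, add_assoc]]
  ring

theorem aux_card_surj (n : ℕ) (g : (Fin n → Fin n) → ℝ) (c : ℝ)
    (hg : ∀ σ : Equiv.Perm (Fin n), g σ = c) :
    (∑ f : Fin n → Fin n, if Finset.image f Finset.univ = Finset.univ then
        (-1 : ℝ) ^ n * g f else 0) = (-1) ^ n * (n.factorial * c) := by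
  rw [← Finset.sum_filter]
  have : ∑ f : Fin n → Fin n with Finset.image f Finset.univ = Finset.univ, (-1 : ℝ) ^ n * g f
      = ∑ σ : Equiv.Perm (Fin n), (-1 : ℝ) ^ n * g σ := by
    symm
    refine Finset.sum_nbij (fun σ => (σ : Fin n → Fin n)) ?_ ?_ ?_ ?_
    · intro σ _
      simp [Finset.image_univ_of_surjective σ.surjective]
    · intro σ _ τ _ h
      exact DFunLike.coe_injective h
    · intro f hf
      simp only [Finset.coe_filter, Finset.mem_univ, true_and, Set.mem_ofPred_eq] at hf
      have hs : Function.Surjective f := by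
        intro y
        have : y ∈ Finset.image f Finset.univ := by simp [hf]
        simpa using this
      have hb : Function.Bijective f := Finite.surjective_iff_bijective.1 hs
      exact ⟨Equiv.ofBijective f hb, by simp, rfl⟩
    · intro _ _
      rfl
  rw [this]
  simp only [hg]
  rw [Finset.sum_const, Finset.card_univ, Fintype.card_perm, Fintype.card_fin, nsmul_eq_mul]
  ring

theorem auxPol_diag {M : Type*} [AddCommMonoid M] (n : ℕ) (f : M → ℝ)
    (hom : ∀ (k : ℕ) p, f (k • p) = (k : ℝ) ^ n * f p) (p : M) :
    auxPol n f (fun _ => p) = f p := by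
  unfold auxPol
  have h := aux_polar (MultilinearMap.mkPiAlgebra ℝ (Fin n) ℝ) (fun (_ : Fin n) _ => (1 : ℝ))
  simp only [MultilinearMap.mkPiAlgebra_apply, Finset.prod_const_one, Fintype.card_fin,
    Finset.sum_const, Finset.prod_const, Finset.card_univ, nsmul_eq_mul, mul_one] at h
  have h2 := aux_card_surj n (fun _ => 1) 1 (fun _ => rfl)
  simp only [mul_one] at h2
  rw [h2] at h
  simp only [Finset.sum_const, hom, ← mul_assoc]
  rw [← Finset.sum_mul, h]
  have : (n.factorial : ℝ) ≠ 0 := by positivity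
  have h3 : ((-1 : ℝ) ^ n) * (-1) ^ n = 1 := by rw [← mul_pow]; simp
  field_simp
  linear_combination f p * h3

theorem auxPol_unique {M : Type*} [AddCommMonoid M] (n : ℕ) (f : M → ℝ)
    (T : MultilinearMap ℕ (fun _ : Fin n => M) ℝ)
    (hs : ∀ v (σ : Equiv.Perm (Fin n)), T (v ∘ σ) = T v) (hd : ∀ p, T (fun _ => p) = f p)
    (v : Fin n → M) : T v = auxPol n f v := by
  unfold auxPol
  have h := aux_polar T (fun i _ => v i)
  simp only [hd, Fintype.card_fin] at h
  rw [aux_card_surj n (fun g => T (fun r => v (g r))) (T v) (fun σ => hs v σ)] at h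
  rw [h]
  have : (n.factorial : ℝ) ≠ 0 := by positivity
  have h3 : ((-1 : ℝ) ^ n) * (-1) ^ n = 1 := by rw [← mul_pow]; simp
  field_simp
  linear_combination - T v * h3

/-- The dot product with `v` as a continuous linear map. -/
noncomputable def auxL {n : ℕ} (v : Fin n → ℝ) : (Fin n → ℝ) →L[ℝ] ℝ :=
  ∑ i, v i • ContinuousLinearMap.proj (R := ℝ) (φ := fun _ : Fin n => ℝ) i

theorem auxL_apply {n : ℕ} (v x : Fin n → ℝ) : auxL v x = v ⬝ᵥ x := by
  simp [auxL, dotProduct]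

/-- Partition function. -/
noncomputable def auxZ {n : ℕ} (V : Finset (Fin n → ℝ)) (x : Fin n → ℝ) : ℝ :=
  ∑ v ∈ V, Real.exp (auxL v x)

/-- Gibbs weights. -/
noncomputable def auxW {n : ℕ} (V : Finset (Fin n → ℝ)) (v x : Fin n → ℝ) : ℝ :=
  Real.exp (auxL v x) / auxZ V x

/-- Gradient of log-sum-exp. -/
noncomputable def auxG {n : ℕ} (V : Finset (Fin n → ℝ)) (x : Fin n → ℝ) : Fin n → ℝ :=
  ∑ v ∈ V, auxW V v x • v

/-- Hessian of log-sum-exp. -/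
noncomputable def auxH {n : ℕ} (V : Finset (Fin n → ℝ)) (x : Fin n → ℝ) :
    Matrix (Fin n) (Fin n) ℝ :=
  ∑ v ∈ V, auxW V v x • Matrix.vecMulVec (v - auxG V x) (v - auxG V x)

theorem auxZ_pos {n : ℕ} {V : Finset (Fin n → ℝ)} (hV : V.Nonempty) (x : Fin n → ℝ) :
    0 < auxZ V x := Finset.sum_pos (fun _ _ => Real.exp_pos _) hV

theorem auxW_pos {n : ℕ} {V : Finset (Fin n → ℝ)} (hV : V.Nonempty) (v x : Fin n → ℝ) :
    0 < auxW V v x := div_pos (Real.exp_pos _) (auxZ_pos hV x)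

theorem auxW_sum {n : ℕ} {V : Finset (Fin n → ℝ)} (hV : V.Nonempty) (x : Fin n → ℝ) :
    ∑ v ∈ V, auxW V v x = 1 := by
  unfold auxW
  rw [← Finset.sum_div]
  exact div_self (auxZ_pos hV x).ne'

theorem auxZ_hasFDerivAt {n : ℕ} (V : Finset (Fin n → ℝ)) (x : Fin n → ℝ) :
    HasFDerivAt (auxZ V) (∑ v ∈ V, Real.exp (auxL v x) • auxL v) x := by
  unfold auxZ
  exact HasFDerivAt.fun_sum fun v _ => (auxL v).hasFDerivAt.exp

theorem auxL_sum_smul {n : ℕ} (V : Finset (Fin n → ℝ)) (w : (Fin n → ℝ) → ℝ) (h : Fin n → ℝ) :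
    auxL (∑ v ∈ V, w v • v) h = ∑ v ∈ V, w v * auxL v h := by
  simp only [auxL_apply, sum_dotProduct, smul_dotProduct, smul_eq_mul]

theorem auxLogZ_hasFDerivAt {n : ℕ} {V : Finset (Fin n → ℝ)} (hV : V.Nonempty) (x : Fin n → ℝ) :
    HasFDerivAt (fun x => Real.log (auxZ V x)) (auxL (auxG V x)) x := by
  convert! (auxZ_hasFDerivAt V x).log (auxZ_pos hV x).ne' using 1
  ext h
  unfold auxG
  rw [auxL_sum_smul]
  simp only [auxW, smul_apply, sum_apply, smul_eq_mul,
    Finset.mul_sum]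
  refine Finset.sum_congr rfl fun v _ => ?_
  ring

theorem auxW_hasFDerivAt {n : ℕ} {V : Finset (Fin n → ℝ)} (hV : V.Nonempty) (v x : Fin n → ℝ) :
    HasFDerivAt (auxW V v) (auxW V v x • auxL (v - auxG V x)) x := by
  have he : auxW V v = fun x => Real.exp (auxL v x - Real.log (auxZ V x)) := by
    ext y
    rw [Real.exp_sub, Real.exp_log (auxZ_pos hV y)]
    rfl
  have h := ((auxL v).hasFDerivAt.sub (auxLogZ_hasFDerivAt hV x)).exp
  rw [he]
  convert! h using 1
  congr 1
  ext h
  simp [auxL_apply, sub_dotProduct]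

theorem auxH_mulVec {n : ℕ} (V : Finset (Fin n → ℝ)) (x h : Fin n → ℝ) :
    (auxH V x).mulVec h =
      ∑ v ∈ V, (auxW V v x * auxL (v - auxG V x) h) • (v - auxG V x) := by
  unfold auxH
  rw [Matrix.sum_mulVec]
  refine Finset.sum_congr rfl fun v _ => ?_
  rw [Matrix.smul_mulVec, Matrix.vecMulVec_mulVec, auxL_apply]
  ext i
  simp
  ring

theorem auxG_hasFDerivAt {n : ℕ} {V : Finset (Fin n → ℝ)} (hV : V.Nonempty) (x : Fin n → ℝ) :
    HasFDerivAt (auxG V) (LinearMap.toContinuousLinearMap (Matrix.toLin' (auxH V x))) x := by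
  have h : HasFDerivAt (auxG V) (∑ v ∈ V, (auxW V v x • auxL (v - auxG V x)).smulRight v) x := by
    unfold auxG
    exact HasFDerivAt.fun_sum fun v _ => (auxW_hasFDerivAt hV v x).smul_const v
  convert h using 1
  ext1 h
  simp only [LinearMap.coe_toContinuousLinearMap', Matrix.toLin'_apply, auxH_mulVec,
    sum_apply, ContinuousLinearMap.smulRight_apply,
    smul_apply, smul_eq_mul]
  simp only [smul_sub, Finset.sum_sub_distrib]
  rw [← Finset.sum_smul, sub_eq_self]
  have : ∑ v ∈ V, auxW V v x * auxL (v - auxG V x) h = 0 := by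
    have h1 : ∀ v, auxL (v - auxG V x) h = auxL v h - auxL (auxG V x) h := by
      intro v
      simp [auxL_apply, sub_dotProduct]
    simp only [h1, mul_sub, Finset.sum_sub_distrib]
    rw [← Finset.sum_mul, auxW_sum hV, ← auxL_sum_smul]
    simp [auxG]
  rw [this, zero_smul]

theorem auxH_dot {n : ℕ} (V : Finset (Fin n → ℝ)) (x h : Fin n → ℝ) :
    h ⬝ᵥ (auxH V x).mulVec h =
      ∑ v ∈ V, auxW V v x * (auxL (v - auxG V x) h) ^ 2 := by
  rw [auxH_mulVec, dotProduct_sum]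
  refine Finset.sum_congr rfl fun v _ => ?_
  rw [dotProduct_smul, dotProduct_comm, ← auxL_apply, smul_eq_mul]
  ring

theorem auxH_posSemidef {n : ℕ} {V : Finset (Fin n → ℝ)} (hV : V.Nonempty) (x : Fin n → ℝ) :
    (auxH V x).PosSemidef := by
  unfold auxH
  refine Matrix.posSemidef_sum _ fun v _ => ?_
  refine Matrix.PosSemidef.smul ?_ (auxW_pos hV v x).le
  simpa using Matrix.posSemidef_vecMulVec_self_star (v - auxG V x)

theorem auxG_mem {n : ℕ} {V : Finset (Fin n → ℝ)} (hV : V.Nonempty) (x : Fin n → ℝ) :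
    auxG V x ∈ convexHull ℝ (V : Set (Fin n → ℝ)) := by
  refine (convex_convexHull ℝ _).sum_mem (fun v _ => (auxW_pos hV v x).le) (auxW_sum hV x)
    fun v hv => subset_convexHull ℝ _ hv

theorem auxZ_cont {n : ℕ} (V : Finset (Fin n → ℝ)) : Continuous (auxZ V) := by
  unfold auxZ
  fun_prop

theorem auxW_cont {n : ℕ} {V : Finset (Fin n → ℝ)} (hV : V.Nonempty) (v : Fin n → ℝ) :
    Continuous (auxW V v) := by
  unfold auxW
  exact (by fun_prop : Continuous fun x => Real.exp (auxL v x)).div (auxZ_cont V)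
    fun x => (auxZ_pos hV x).ne'

theorem auxG_cont {n : ℕ} {V : Finset (Fin n → ℝ)} (hV : V.Nonempty) : Continuous (auxG V) :=
  continuous_finsetSum _ fun v _ => (auxW_cont hV v).smul continuous_const

theorem auxH_cont {n : ℕ} {V : Finset (Fin n → ℝ)} (hV : V.Nonempty) : Continuous (auxH V) :=
  continuous_finsetSum _ fun v _ => (auxW_cont hV v).smul
    ((continuous_const.sub (auxG_cont hV)).matrix_vecMulVec (continuous_const.sub (auxG_cont hV)))

theorem auxL_le_logZ {n : ℕ} {V : Finset (Fin n → ℝ)} (x z : Fin n → ℝ)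
    (hz : z ∈ convexHull ℝ (V : Set (Fin n → ℝ))) : auxL z x ≤ Real.log (auxZ V x) := by
  have hsub : convexHull ℝ (V : Set (Fin n → ℝ)) ⊆ {z | auxL z x ≤ Real.log (auxZ V x)} := by
    refine convexHull_min ?_ ?_
    · intro v hv
      have hv' : v ∈ V := hv
      have : Real.exp (auxL v x) ≤ auxZ V x :=
        Finset.single_le_sum (f := fun v => Real.exp (auxL v x))
          (fun _ _ => (Real.exp_pos _).le) hv'
      change auxL v x ≤ _
      rw [Real.le_log_iff_exp_le (lt_of_lt_of_le (Real.exp_pos _) this)]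
      exact this
    · have : {z | auxL z x ≤ Real.log (auxZ V x)} = {z | auxL x z ≤ Real.log (auxZ V x)} := by
        simp only [auxL_apply, dotProduct_comm x]
      rw [this]
      exact convex_halfSpace_le (auxL x).toLinearMap.isLinear _
  exact hsub hz

theorem aux_isCompact_sum {n : ℕ} {ι : Type*} (S : Finset ι) (K : ι → Set (Fin n → ℝ))
    (hK : ∀ i ∈ S, IsCompact (K i)) : IsCompact (∑ i ∈ S, K i) := by
  classical
  induction S using Finset.induction_on with
  | empty => simp
  | insert a s ha ih =>
    rw [Finset.sum_insert ha]
    exact (hK a (by simp)).add (ih fun i hi => hK i (by simp [hi]))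

theorem aux_vol_deg {n : ℕ} (K : Set (Fin n → ℝ)) (d : Fin n → ℝ) (hd : d ≠ 0)
    (h : ∀ x ∈ K, ∀ y ∈ K, auxL d x = auxL d y) : volume K = 0 := by
  rcases K.eq_empty_or_nonempty with rfl | ⟨z, hz⟩
  · simp
  have hker : LinearMap.ker (auxL d).toLinearMap ≠ ⊤ := by
    intro hk
    have : d ∈ LinearMap.ker (auxL d).toLinearMap := by rw [hk]; trivial
    have h2 : d ⬝ᵥ d = 0 := by simpa [auxL_apply] using this
    exact hd (dotProduct_self_eq_zero.1 h2)
  have hsub : K ⊆ (fun x => x + (-z)) ⁻¹' (LinearMap.ker (auxL d).toLinearMap : Set (Fin n → ℝ)) := by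
    intro x hx
    simp only [Set.mem_preimage, SetLike.mem_coe, LinearMap.mem_ker, ContinuousLinearMap.coe_coe,
      map_add, map_neg]
    rw [h x hx z hz]
    ring
  refine measure_mono_null hsub ?_
  rw [measure_preimage_add_right]
  exact Measure.addHaar_submodule _ _ hker

theorem aux_hull_const {n : ℕ} (V : Set (Fin n → ℝ)) (d : Fin n → ℝ)
    (h : ∀ x ∈ V, ∀ y ∈ V, auxL d x = auxL d y) :
    ∀ x ∈ convexHull ℝ V, ∀ y ∈ convexHull ℝ V, auxL d x = auxL d y := by
  rcases V.eq_empty_or_nonempty with rfl | ⟨z, hz⟩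
  · simp
  have : convexHull ℝ V ⊆ {x | auxL d x = auxL d z} :=
    convexHull_min (fun x hx => h x hx z hz)
      (convex_hyperplane (auxL d).toLinearMap.isLinear _)
  intro x hx y hy
  exact (this hx).trans (this hy).symm

theorem aux_vol {n : ℕ} {ι : Type*} (V : ι → Finset (Fin n → ℝ)) (hV : ∀ i, (V i).Nonempty)
    (S : Finset ι) :
    Integrable (fun x => (∑ i ∈ S, auxH (V i) x).det) ∧
    ∫ x, (∑ i ∈ S, auxH (V i) x).det =
      (volume (∑ i ∈ S, convexHull ℝ (V i : Set (Fin n → ℝ)))).toReal := by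
  set K := ∑ i ∈ S, convexHull ℝ (V i : Set (Fin n → ℝ)) with hK
  by_cases hdeg : ∃ d : Fin n → ℝ, d ≠ 0 ∧ ∀ i ∈ S, ∀ v ∈ V i, ∀ v' ∈ V i, auxL d v = auxL d v'
  · obtain ⟨d, hd, hc⟩ := hdeg
    have hc' := fun i hi => aux_hull_const (V i : Set (Fin n → ℝ)) d (hc i hi)
    have hvol : volume K = 0 := by
      refine aux_vol_deg K d hd ?_
      intro x hx y hy
      obtain ⟨a, ha, rfl⟩ := (Set.mem_finsetSum _ _ _).1 hx
      obtain ⟨b, hb, rfl⟩ := (Set.mem_finsetSum _ _ _).1 hy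
      rw [map_sum, map_sum]
      exact Finset.sum_congr rfl fun i hi => hc' i hi _ (ha hi) _ (hb hi)
    have hdet : ∀ x, (∑ i ∈ S, auxH (V i) x).det = 0 := by
      intro x
      refine Matrix.exists_mulVec_eq_zero_iff.1 ⟨d, hd, ?_⟩
      rw [Matrix.sum_mulVec]
      refine Finset.sum_eq_zero fun i hi => ?_
      rw [auxH_mulVec]
      refine Finset.sum_eq_zero fun v hv => ?_
      have : auxL (v - auxG (V i) x) d = 0 := by
        rw [auxL_apply, dotProduct_comm, ← auxL_apply, map_sub, sub_eq_zero]
        exact hc' i hi _ (subset_convexHull ℝ _ hv) _ (auxG_mem (hV i) x)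
      rw [this]
      simp
    simp [hdet, hvol]
  · push Not at hdeg
    set G : (Fin n → ℝ) → (Fin n → ℝ) := fun x => ∑ i ∈ S, auxG (V i) x with hG
    set H : (Fin n → ℝ) → Matrix (Fin n) (Fin n) ℝ := fun x => ∑ i ∈ S, auxH (V i) x with hH
    have hGd : ∀ x, HasFDerivAt G (LinearMap.toContinuousLinearMap (Matrix.toLin' (H x))) x := by
      intro x
      have := HasFDerivAt.fun_sum (u := S) fun i _ => auxG_hasFDerivAt (hV i) x
      convert! this using 1
      simp [hH, map_sum]
    have hHc : Continuous H := continuous_finsetSum _ fun i _ => auxH_cont (hV i)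
    have hdetc : Continuous fun x => (H x).det := hHc.matrix_det
    have hdet0 : ∀ x, 0 ≤ (H x).det := fun x =>
      (Matrix.posSemidef_sum _ fun i _ => auxH_posSemidef (hV i) x).det_nonneg
    have hpos : ∀ x d : Fin n → ℝ, d ≠ 0 → 0 < d ⬝ᵥ (H x).mulVec d := by
      intro x d hd
      simp only [hH]
      rw [Matrix.sum_mulVec, dotProduct_sum]
      simp only [auxH_dot]
      obtain ⟨i, hi, v, hv, v', hv', hne⟩ := hdeg d hd
      have hterm : ∀ i, ∀ v, 0 ≤ auxW (V i) v x * (auxL (v - auxG (V i) x) d) ^ 2 :=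
        fun i v => mul_nonneg (auxW_pos (hV i) v x).le (sq_nonneg _)
      refine Finset.sum_pos' (fun i _ => Finset.sum_nonneg fun v _ => hterm i v) ⟨i, hi, ?_⟩
      have key : ∀ u ∈ V i, auxL d u ≠ auxL d (auxG (V i) x) →
          0 < ∑ v ∈ V i, auxW (V i) v x * (auxL (v - auxG (V i) x) d) ^ 2 := by
        intro u hu hun
        refine Finset.sum_pos' (fun v _ => hterm i v) ⟨u, hu, ?_⟩
        refine mul_pos (auxW_pos (hV i) u x) ?_
        have : auxL (u - auxG (V i) x) d ≠ 0 := by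
          rw [auxL_apply, dotProduct_comm, ← auxL_apply, map_sub, sub_ne_zero]
          exact hun
        positivity
      by_cases h1 : auxL d v = auxL d (auxG (V i) x)
      · exact key v' hv' (fun h2 => hne (h1.trans h2.symm))
      · exact key v hv h1
    have hinj : Function.Injective G := by
      intro x y hxy
      by_contra hne
      set d := y - x with hd
      have hd0 : d ≠ 0 := sub_ne_zero.2 (Ne.symm hne)
      have hφ : ∀ t : ℝ, HasDerivAt (fun t : ℝ => auxL d (G (x + t • d)))
          (d ⬝ᵥ (H (x + t • d)).mulVec d) t := by
        intro t
        have h1 : HasDerivAt (fun t : ℝ => x + t • d) d t := by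
          simpa using ((hasDerivAt_id t).smul_const d).const_add x
        have h2 := (hGd (x + t • d)).comp_hasDerivAt t h1
        have h3 := (auxL d).hasFDerivAt.comp_hasDerivAt t h2
        convert! h3 using 1
        simp [auxL_apply]
      have hmono : StrictMono (fun t : ℝ => auxL d (G (x + t • d))) :=
        strictMono_of_deriv_pos fun t => by
          rw [(hφ t).deriv]
          exact hpos _ d hd0
      have := hmono (zero_lt_one' ℝ)
      simp [hd, hxy] at this
    have himg : G '' Set.univ ⊆ K := by
      rintro _ ⟨x, _, rfl⟩
      exact (Set.mem_finsetSum _ _ _).2 ⟨_, fun {i} _ => auxG_mem (hV i) x, rfl⟩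
    have hsurj : interior K ⊆ G '' Set.univ := by
      intro y hy
      obtain ⟨r, hr, hball⟩ := Metric.mem_nhds_iff.1 (mem_interior_iff_mem_nhds.1 hy)
      set F : (Fin n → ℝ) → ℝ := fun x => ∑ i ∈ S, Real.log (auxZ (V i) x) - auxL y x with hF
      have hFd : ∀ x, HasFDerivAt F (∑ i ∈ S, auxL (auxG (V i) x) - auxL y) x := fun x =>
        (HasFDerivAt.fun_sum fun i _ => auxLogZ_hasFDerivAt (hV i) x).sub (auxL y).hasFDerivAt
      have hFc : Continuous F := continuous_iff_continuousAt.2 fun x => (hFd x).continuousAt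
      have hFlow : ∀ x, r / 2 * ‖x‖ ≤ F x := by
        intro x
        set z := y + (r / 2 * ‖x‖⁻¹) • x with hz
        have hzK : z ∈ K := by
          apply hball
          rw [mem_ball_iff_norm, hz, add_sub_cancel_left, norm_smul, norm_mul, norm_inv, norm_norm]
          rw [Real.norm_of_nonneg (by positivity)]
          rcases eq_or_ne ‖x‖ 0 with h0 | h0
          · simp [h0, hr]
          · rw [mul_assoc, inv_mul_cancel₀ h0]
            linarith
        obtain ⟨a, ha, hsum⟩ := (Set.mem_finsetSum _ _ _).1 hzK
        have h1 : auxL z x ≤ ∑ i ∈ S, Real.log (auxZ (V i) x) := by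
          rw [← hsum, auxL_apply, sum_dotProduct]
          refine Finset.sum_le_sum fun i hi => ?_
          rw [← auxL_apply]
          exact auxL_le_logZ x _ (ha hi)
        have h2 : auxL z x = auxL y x + (r / 2 * ‖x‖⁻¹) * (x ⬝ᵥ x) := by
          rw [hz, auxL_apply, add_dotProduct, smul_dotProduct, auxL_apply, smul_eq_mul]
        have h3 : ‖x‖ ^ 2 ≤ x ⬝ᵥ x := by
          have hnn : 0 ≤ x ⬝ᵥ x := Finset.sum_nonneg fun i _ => mul_self_nonneg (x i)
          have h4 : ‖x‖ ≤ Real.sqrt (x ⬝ᵥ x) := by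
            rw [pi_norm_le_iff_of_nonneg (Real.sqrt_nonneg _)]
            intro i
            apply Real.le_sqrt_of_sq_le
            rw [Real.norm_eq_abs, sq_abs, sq]
            exact Finset.single_le_sum (f := fun i => x i * x i)
              (fun i _ => mul_self_nonneg (x i)) (Finset.mem_univ i)
          calc ‖x‖ ^ 2 ≤ (Real.sqrt (x ⬝ᵥ x)) ^ 2 := by gcongr
            _ = _ := Real.sq_sqrt hnn
        have h5 : r / 2 * ‖x‖ ≤ (r / 2 * ‖x‖⁻¹) * (x ⬝ᵥ x) := by
          rcases eq_or_ne ‖x‖ 0 with h0 | h0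
          · simp [h0]
          · calc r / 2 * ‖x‖ = (r / 2 * ‖x‖⁻¹) * ‖x‖ ^ 2 := by field_simp
              _ ≤ _ := by gcongr
        simp only [hF]
        linarith
      have hcoer : Filter.Tendsto F (Filter.cocompact _) Filter.atTop := by
        refine Filter.tendsto_atTop_mono hFlow ?_
        exact Filter.Tendsto.const_mul_atTop (by positivity) (tendsto_norm_cocompact_atTop)
      obtain ⟨x, hx⟩ := hFc.exists_forall_le hcoer
      have hmin : IsLocalMin F x := Filter.Eventually.of_forall hx
      have h0 := hmin.hasFDerivAt_eq_zero (hFd x)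
      refine ⟨x, trivial, ?_⟩
      have h1 : ∀ h, (G x - y) ⬝ᵥ h = 0 := by
        intro h
        have := congrArg (fun L : (Fin n → ℝ) →L[ℝ] ℝ => L h) h0
        simpa [auxL_apply, hG, sub_dotProduct, sum_dotProduct, sum_apply] using this
      exact sub_eq_zero.1 (dotProduct_self_eq_zero.1 (h1 _))
    have hKconv : Convex ℝ K := by
      rw [hK, ← convexHull_sum]
      exact convex_convexHull ℝ _
    have hKcomp : IsCompact K := by
      exact aux_isCompact_sum S _ fun i _ => (V i).finite_toSet.isCompact_convexHull ℝ
    have hvol : volume (G '' Set.univ) = volume K := by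
      refine le_antisymm (measure_mono himg) ?_
      calc volume K ≤ volume (interior K ∪ frontier K) := measure_mono (by
              rw [← closure_eq_interior_union_frontier]; exact subset_closure)
        _ ≤ volume (interior K) + volume (frontier K) := measure_union_le _ _
        _ = volume (interior K) := by rw [hKconv.addHaar_frontier volume, add_zero]
        _ ≤ _ := measure_mono hsurj
    have hcv := lintegral_abs_det_fderiv_eq_addHaar_image volume MeasurableSet.univ
      (fun x _ => (hGd x).hasFDerivWithinAt) hinj.injOn
    rw [hvol, Measure.restrict_univ] at hcv
    have hcv' : ∫⁻ x, ENNReal.ofReal ((H x).det) = volume K := by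
      rw [← hcv]
      refine lintegral_congr fun x => ?_
      rw [LinearMap.det_toContinuousLinearMap, LinearMap.det_toLin', abs_of_nonneg (hdet0 x)]
    constructor
    · refine ⟨hdetc.aestronglyMeasurable, ?_⟩
      rw [hasFiniteIntegral_iff_ofReal (Filter.Eventually.of_forall hdet0), hcv']
      exact hKcomp.measure_lt_top
    · rw [integral_eq_lintegral_of_nonneg_ae (Filter.Eventually.of_forall hdet0)
        hdetc.aestronglyMeasurable, hcv']

theorem aux_vanish_polytope {n : ℕ} {ι : Type*} [Fintype ι] [DecidableEq ι]
    (hι : n < Fintype.card ι)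
    (V : ι → Finset (Fin n → ℝ)) (hV : ∀ i, (V i).Nonempty) :
    ∑ S : Finset ι, (-1 : ℝ) ^ S.card *
      (volume (∑ i ∈ S, convexHull ℝ (V i : Set (Fin n → ℝ)))).toReal = 0 := by
  simp only [← (aux_vol V hV _).2, ← integral_const_mul]
  rw [← integral_finsetSum _ fun S _ => (aux_vol V hV S).1.const_mul _]
  have : ∀ x, ∑ S : Finset ι, (-1 : ℝ) ^ S.card * (∑ i ∈ S, auxH (V i) x).det = 0 := by
    intro x
    have h := aux_polar (Matrix.detRowAlternating (n := Fin n) (R := ℝ)).toMultilinearMap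
      (fun i r => auxH (V i) x r)
    have e : ∀ S : Finset ι, (∑ i ∈ S, auxH (V i) x).det =
        (Matrix.detRowAlternating (n := Fin n) (R := ℝ)).toMultilinearMap
          (fun r => ∑ i ∈ S, auxH (V i) x r) := by
      intro S
      change (∑ i ∈ S, auxH (V i) x).det = Matrix.det (fun r => ∑ i ∈ S, auxH (V i) x r)
      congr 1
      ext r c
      simp [Matrix.sum_apply]
    simp only [e, h]
    refine Finset.sum_eq_zero fun f _ => ?_
    rw [if_neg]
    intro hc
    have h1 := Finset.card_image_le (s := Finset.univ) (f := f)
    rw [hc, Finset.card_univ, Finset.card_univ, Fintype.card_fin] at h1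
    omega
  simp [this]

theorem aux_sum_subset {n : ℕ} {ι : Type*} (S : Finset ι) (K L : ι → Set (Fin n → ℝ))
    (h : ∀ i, K i ⊆ L i) : ∑ i ∈ S, K i ⊆ ∑ i ∈ S, L i := by
  intro x hx
  obtain ⟨a, ha, rfl⟩ := (Set.mem_finsetSum _ _ _).1 hx
  exact (Set.mem_finsetSum _ _ _).2 ⟨a, fun hi => h _ (ha hi), rfl⟩

theorem aux_convex_sum {n : ℕ} {ι : Type*} (S : Finset ι) (K : ι → Set (Fin n → ℝ))
    (hK : ∀ i ∈ S, Convex ℝ (K i)) : Convex ℝ (∑ i ∈ S, K i) := by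
  classical
  induction S using Finset.induction_on with
  | empty => exact convex_singleton (𝕜 := ℝ) (0 : Fin n → ℝ)
  | insert a s ha ih =>
    rw [Finset.sum_insert ha]
    exact (hK a (by simp)).add (ih fun i hi => hK i (by simp [hi]))

theorem aux_vanish_convex {n : ℕ} {ι : Type*} [Fintype ι] [DecidableEq ι]
    (hι : n < Fintype.card ι)
    (K : ι → Set (Fin n → ℝ)) (hc : ∀ i, IsCompact (K i)) (hconv : ∀ i, Convex ℝ (K i))
    (hne : ∀ i, (K i).Nonempty) :
    ∑ S : Finset ι, (-1 : ℝ) ^ S.card * (volume (∑ i ∈ S, K i)).toReal = 0 := by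
  classical
  have hD : ∀ i, ∃ D : ℕ → (Fin n → ℝ), (∀ k, D k ∈ K i) ∧ K i ⊆ closure (Set.range D) := by
    intro i
    have : Nonempty (K i) := (hne i).to_subtype
    refine ⟨fun k => (TopologicalSpace.denseSeq (K i) k : Fin n → ℝ), fun k => Subtype.coe_prop _, ?_⟩
    intro x hx
    have h1 : (⟨x, hx⟩ : K i) ∈ closure (Set.range (TopologicalSpace.denseSeq (K i))) :=
      TopologicalSpace.denseRange_denseSeq (K i) _
    have h2 := image_closure_subset_closure_image continuous_subtype_val
      (Set.mem_image_of_mem (Subtype.val : K i → Fin n → ℝ) h1)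
    rw [← Set.range_comp] at h2
    exact h2
  choose D hDK hDd using hD
  set V : ℕ → ι → Finset (Fin n → ℝ) := fun m i => (Finset.range (m + 1)).image (D i) with hVdef
  have hVne : ∀ m i, (V m i).Nonempty := fun m i => ⟨D i 0, by
    simp only [hVdef, Finset.mem_image, Finset.mem_range]
    exact ⟨0, by omega, rfl⟩⟩
  have hVK : ∀ m i, convexHull ℝ (V m i : Set (Fin n → ℝ)) ⊆ K i := fun m i =>
    convexHull_min (by
      intro x hx
      simp only [hVdef, Finset.coe_image] at hx
      obtain ⟨k, _, rfl⟩ := hx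
      exact hDK i k) (hconv i)
  have hlim : ∀ S : Finset ι, Filter.Tendsto
      (fun m => (volume (∑ i ∈ S, convexHull ℝ (V m i : Set (Fin n → ℝ)))).toReal) Filter.atTop
      (nhds (volume (∑ i ∈ S, K i)).toReal) := by
    intro S
    set P : ℕ → Set (Fin n → ℝ) := fun m => ∑ i ∈ S, convexHull ℝ (V m i : Set (Fin n → ℝ)) with hP
    have hmono : Monotone P := by
      intro m m' hm
      refine aux_sum_subset S _ _ fun i => convexHull_mono ?_
      simp only [hVdef, Finset.coe_subset]
      exact Finset.image_subset_image (Finset.range_subset_range.2 (by omega))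
    have hPK : (⋃ m, P m) ⊆ ∑ i ∈ S, K i :=
      Set.iUnion_subset fun m => aux_sum_subset S _ _ fun i => hVK m i
    have hUconv : Convex ℝ (⋃ m, P m) :=
      hmono.directed_le.convex_iUnion fun m =>
        aux_convex_sum S _ fun i _ => convex_convexHull ℝ _
    have hKcl : ∑ i ∈ S, K i ⊆ closure (⋃ m, P m) := by
      intro x hx
      obtain ⟨a, ha, rfl⟩ := (Set.mem_finsetSum _ _ _).1 hx
      set a' : ι → Fin n → ℝ := fun i => if i ∈ S then a i else D i 0 with ha'
      have hsum : ∑ i ∈ S, a i = ∑ i ∈ S, a' i :=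
        Finset.sum_congr rfl fun i hi => by simp [ha', hi]
      have h1 : a' ∈ closure (Set.pi Set.univ fun i => Set.range (D i)) := by
        rw [closure_pi_set]
        intro i _
        apply hDd i
        by_cases hi : i ∈ S
        · simp only [ha', hi, if_true]; exact ha hi
        · simp only [ha', hi, if_false]; exact hDK i 0
      have hcont : Continuous fun b : ι → Fin n → ℝ => ∑ i ∈ S, b i := by fun_prop
      have h2 := image_closure_subset_closure_image hcont (Set.mem_image_of_mem _ h1)
      rw [hsum]
      refine closure_mono ?_ h2
      rintro _ ⟨b, hb, rfl⟩
      have hb' : ∀ i, ∃ k, D i k = b i := fun i => hb i trivial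
      choose k hk using hb'
      refine Set.mem_iUnion.2 ⟨Finset.univ.sup k, (Set.mem_finsetSum _ _ _).2 ⟨b, ?_, rfl⟩⟩
      intro i _
      apply subset_convexHull
      simp only [hVdef, Finset.coe_image]
      exact ⟨k i, by
        have := Finset.le_sup (f := k) (Finset.mem_univ i)
        simp only [Finset.coe_range, Set.mem_Iio]; omega, hk i⟩
    have hKc : IsCompact (∑ i ∈ S, K i) := aux_isCompact_sum S K fun i _ => hc i
    have hvol : volume (∑ i ∈ S, K i) = volume (⋃ m, P m) := by
      refine le_antisymm ?_ (measure_mono hPK)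
      calc volume (∑ i ∈ S, K i) ≤ volume ((⋃ m, P m) ∪ frontier (⋃ m, P m)) :=
            measure_mono (hKcl.trans (closure_eq_self_union_frontier _).subset)
        _ ≤ volume (⋃ m, P m) + volume (frontier (⋃ m, P m)) := measure_union_le _ _
        _ = volume (⋃ m, P m) := by rw [hUconv.addHaar_frontier volume, add_zero]
    rw [hvol]
    refine (ENNReal.tendsto_toReal ?_).comp (tendsto_measure_iUnion_atTop hmono)
    rw [← hvol]
    exact hKc.measure_lt_top.ne
  have hlim2 := tendsto_finsetSum (Finset.univ : Finset (Finset ι))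
    fun S _ => (hlim S).const_mul ((-1 : ℝ) ^ S.card)
  simp only [aux_vanish_polytope hι (V _) (hVne _)] at hlim2
  exact tendsto_nhds_unique hlim2 tendsto_const_nhds

/-- Properties of the cone which we use. -/
structure AuxCone {n : ℕ} (C : Set (Fin n → ℝ)) (l : (Fin n → ℝ) →L[ℝ] ℝ) (c : ℝ) : Prop where
  closed : IsClosed C
  zero_mem : (0 : Fin n → ℝ) ∈ C
  add_mem : ∀ x ∈ C, ∀ y ∈ C, x + y ∈ C
  smul_mem : ∀ t : ℝ, 0 ≤ t → ∀ x ∈ C, t • x ∈ C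
  c_pos : 0 < c
  le : ∀ x ∈ C, c * ‖x‖ ≤ l x

theorem auxCone_exists (n : ℕ) (C : Set (Fin n → ℝ))
    (hCpoly : ∃ V : Finset (Fin n → ℚ),
      C = {x | ∀ v ∈ V, 0 ≤ ∑ i, (v i : ℝ) * x i})
    (hCpointed : ∀ x ∈ C, -x ∈ C → x = 0) : ∃ l c, AuxCone C l c := by
  obtain ⟨V, hV⟩ := hCpoly
  set u : (Fin n → ℚ) → (Fin n → ℝ) := fun v i => (v i : ℝ) with hu
  have hmem : ∀ x, x ∈ C ↔ ∀ v ∈ V, 0 ≤ auxL (u v) x := by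
    intro x
    rw [hV]
    simp [auxL_apply, dotProduct, hu]
  have hclosed : IsClosed C := by
    have : C = ⋂ v ∈ V, {x | 0 ≤ auxL (u v) x} := by
      ext x
      simp [hmem]
    rw [this]
    exact isClosed_biInter fun v _ => isClosed_le continuous_const (auxL (u v)).continuous
  have hsmul : ∀ t : ℝ, 0 ≤ t → ∀ x ∈ C, t • x ∈ C := by
    intro t ht x hx
    rw [hmem] at hx ⊢
    intro v hv
    rw [map_smul, smul_eq_mul]
    exact mul_nonneg ht (hx v hv)
  set l : (Fin n → ℝ) →L[ℝ] ℝ := ∑ v ∈ V, auxL (u v) with hl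
  have hlpos : ∀ x ∈ C, x ≠ 0 → 0 < l x := by
    intro x hx hx0
    have h0 : 0 ≤ l x := by
      rw [hl, sum_apply]
      exact Finset.sum_nonneg fun v hv => (hmem x).1 hx v hv
    refine lt_of_le_of_ne h0 fun h => hx0 (hCpointed x hx ?_)
    rw [hl, sum_apply, eq_comm, Finset.sum_eq_zero_iff_of_nonneg fun v hv => (hmem x).1 hx v hv] at h
    rw [hmem]
    intro v hv
    rw [map_neg, h v hv, neg_zero]
  have hc : ∃ c : ℝ, 0 < c ∧ ∀ x ∈ C, ‖x‖ = 1 → c ≤ l x := by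
    have hcomp : IsCompact (C ∩ Metric.sphere (0 : Fin n → ℝ) 1) :=
      (isCompact_sphere _ _).inter_left hclosed
    rcases (C ∩ Metric.sphere (0 : Fin n → ℝ) 1).eq_empty_or_nonempty with he | hne
    · refine ⟨1, one_pos, fun x hx hx1 => ?_⟩
      have : x ∈ C ∩ Metric.sphere (0 : Fin n → ℝ) 1 := ⟨hx, by simpa using hx1⟩
      rw [he] at this
      exact this.elim
    · obtain ⟨z, hz, hmin⟩ := hcomp.exists_isMinOn hne l.continuous.continuousOn
      refine ⟨l z, hlpos z hz.1 ?_, fun x hx hx1 => hmin ⟨hx, by simpa using hx1⟩⟩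
      rintro rfl
      simpa using hz.2
  obtain ⟨c, hc0, hc⟩ := hc
  refine ⟨l, c, hclosed, ?_, ?_, hsmul, hc0, ?_⟩
  · rw [hmem]; simp
  · intro x hx y hy
    rw [hmem] at hx hy ⊢
    intro v hv
    rw [map_add]
    exact add_nonneg (hx v hv) (hy v hv)
  · intro x hx
    rcases eq_or_ne x 0 with rfl | hx0
    · simp
    have hn : 0 < ‖x‖ := norm_pos_iff.2 hx0
    have h1 := hc (‖x‖⁻¹ • x) (hsmul _ (by positivity) x hx) (by
      rw [norm_smul, norm_inv, norm_norm, inv_mul_cancel₀ hn.ne'])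
    rw [map_smul, smul_eq_mul, le_inv_mul_iff₀ hn] at h1
    linarith

section
variable {n : ℕ} {C : Set (Fin n → ℝ)} {l : (Fin n → ℝ) →L[ℝ] ℝ} {c : ℝ}

theorem AuxCone.convex (hC : AuxCone C l c) : Convex ℝ C := by
  intro x hx y hy a b ha hb _
  exact hC.add_mem _ (hC.smul_mem a ha x hx) _ (hC.smul_mem b hb y hy)

theorem AuxCone.add_self (hC : AuxCone C l c) : C + C = C := by
  ext x
  constructor
  · rintro ⟨a, ha, b, hb, rfl⟩
    exact hC.add_mem a ha b hb
  · intro hx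
    exact ⟨x, hx, 0, hC.zero_mem, add_zero x⟩

theorem AuxCone.l_nonneg (hC : AuxCone C l c) (x : Fin n → ℝ) (hx : x ∈ C) : 0 ≤ l x :=
  le_trans (mul_nonneg hC.c_pos.le (norm_nonneg x)) (hC.le x hx)

theorem IsLatticePolytope.compact {A : Set (Fin n → ℝ)} (hA : IsLatticePolytope A) :
    IsCompact A := by
  obtain ⟨V, hV, -, -, rfl⟩ := hA
  exact hV.isCompact_convexHull ℝ

theorem IsLatticePolytope.convex {A : Set (Fin n → ℝ)} (hA : IsLatticePolytope A) :
    Convex ℝ A := by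
  obtain ⟨V, hV, -, -, rfl⟩ := hA
  exact convex_convexHull ℝ _

theorem IsLatticePolytope.nonempty {A : Set (Fin n → ℝ)} (hA : IsLatticePolytope A) :
    A.Nonempty := by
  obtain ⟨V, hV, hne, -, rfl⟩ := hA
  exact hne.convexHull

theorem IsLatticePolytope.add {A B : Set (Fin n → ℝ)} (hA : IsLatticePolytope A)
    (hB : IsLatticePolytope B) : IsLatticePolytope (A + B) := by
  obtain ⟨V, hV, hne, hl, rfl⟩ := hA
  obtain ⟨W, hW, hne', hl', rfl⟩ := hB
  refine ⟨V + W, hV.add hW, hne.add hne', ?_, (convexHull_add V W).symm⟩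
  rintro _ ⟨a, ha, b, hb, rfl⟩ i
  obtain ⟨m, hm⟩ := hl a ha i
  obtain ⟨k, hk⟩ := hl' b hb i
  exact ⟨m + k, by simp [hm, hk]⟩

theorem isRelPoly_zero (hC : AuxCone C l c) : IsRelPoly C (C, C) := by
  have h0 : IsLatticePolytope ({0} : Set (Fin n → ℝ)) :=
    ⟨{0}, Set.finite_singleton _, Set.singleton_nonempty _, by
      rintro x rfl i
      exact ⟨0, by simp⟩, by simp⟩
  refine ⟨⟨{0}, h0, by simp⟩, ⟨{0}, h0, by simp⟩, by simp⟩

theorem aux_bdd (hC : AuxCone C l c) (P₁ P₂ : Set (Fin n → ℝ)) (B₁ B₂ : Set (Fin n → ℝ))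
    (hP₁ : Bornology.IsBounded P₁) (hP₂ : Bornology.IsBounded P₂)
    (h₁ : Bornology.IsBounded ((P₁ + C) \ B₁)) (h₂ : Bornology.IsBounded ((P₂ + C) \ B₂)) :
    Bornology.IsBounded (((P₁ + C) + (P₂ + C)) \ (B₁ + B₂)) := by
  obtain ⟨R₁, hR₁⟩ := isBounded_iff_forall_norm_le.1 hP₁
  obtain ⟨R₂, hR₂⟩ := isBounded_iff_forall_norm_le.1 hP₂
  obtain ⟨D₁, hD₁⟩ := isBounded_iff_forall_norm_le.1 h₁
  obtain ⟨D₂, hD₂⟩ := isBounded_iff_forall_norm_le.1 h₂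
  refine isBounded_iff_forall_norm_le.2 ⟨max (2 * D₁ + 3 * R₁ + R₂) (2 * D₂ + R₁ + 3 * R₂), ?_⟩
  rintro _ ⟨⟨_, ⟨p₁, hp₁, c₁, hc₁, rfl⟩, _, ⟨p₂, hp₂, c₂, hc₂, rfl⟩, rfl⟩, hx⟩
  simp only at hx ⊢
  set d := (1 / 2 : ℝ) • (c₁ + c₂) with hd
  have hdC : d ∈ C := hC.smul_mem _ (by norm_num) _ (hC.add_mem _ hc₁ _ hc₂)
  have hdd : d + d = c₁ + c₂ := by
    rw [hd, ← add_smul]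
    norm_num
  have hsum : p₁ + c₁ + (p₂ + c₂) = (p₁ + d) + (p₂ + d) := by
    calc p₁ + c₁ + (p₂ + c₂) = p₁ + p₂ + (c₁ + c₂) := by abel
      _ = _ := by rw [← hdd]; abel
  have n1 := hR₁ p₁ hp₁
  have n2 := hR₂ p₂ hp₂
  have htot : ‖p₁ + c₁ + (p₂ + c₂)‖ ≤ ‖p₁‖ + ‖p₂‖ + (‖d‖ + ‖d‖) := by
    have e : p₁ + c₁ + (p₂ + c₂) = (p₁ + p₂) + (d + d) := by rw [hsum]; abel
    rw [e]
    exact (norm_add_le _ _).trans (add_le_add (norm_add_le _ _) (norm_add_le _ _))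
  by_cases hb₁ : p₁ + d ∈ B₁
  · by_cases hb₂ : p₂ + d ∈ B₂
    · exact absurd ⟨_, hb₁, _, hb₂, hsum.symm⟩ hx
    · have := hD₂ (p₂ + d) ⟨⟨p₂, hp₂, d, hdC, rfl⟩, hb₂⟩
      have h3 : ‖d‖ ≤ ‖p₂ + d‖ + ‖p₂‖ := by
        have := norm_sub_le (p₂ + d) p₂
        rwa [add_sub_cancel_left] at this
      refine le_trans ?_ (le_max_right _ _)
      linarith
  · have := hD₁ (p₁ + d) ⟨⟨p₁, hp₁, d, hdC, rfl⟩, hb₁⟩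
    have h3 : ‖d‖ ≤ ‖p₁ + d‖ + ‖p₁‖ := by
      have := norm_sub_le (p₁ + d) p₁
      rwa [add_sub_cancel_left] at this
    refine le_trans ?_ (le_max_left _ _)
    linarith

theorem IsRelPoly.addPair (hC : AuxCone C l c) {p q : Set (Fin n → ℝ) × Set (Fin n → ℝ)}
    (hp : IsRelPoly C p) (hq : IsRelPoly C q) : IsRelPoly C (addPair p q) := by
  obtain ⟨p1, p2⟩ := p
  obtain ⟨q1, q2⟩ := q
  obtain ⟨⟨A, hA, h1⟩, ⟨B, hB, h2⟩, hb⟩ := hp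
  obtain ⟨⟨A', hA', h1'⟩, ⟨B', hB', h2'⟩, hb'⟩ := hq
  simp only at h1 h2 h1' h2'
  subst h1 h2 h1' h2'
  have e : ∀ X Y : Set (Fin n → ℝ), (X + C) + (Y + C) = (X + Y) + C := by
    intro X Y
    rw [add_add_add_comm, hC.add_self]
  refine ⟨⟨A + A', hA.add hA', e _ _⟩, ⟨B + B', hB.add hB', e _ _⟩, ?_⟩
  simp only [Bornology.isBounded_union] at hb hb' ⊢
  exact ⟨aux_bdd hC A A' _ _ hA.compact.isBounded hA'.compact.isBounded hb.1 hb'.1,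
    aux_bdd hC B B' _ _ hB.compact.isBounded hB'.compact.isBounded hb.2 hb'.2⟩

theorem IsRelPoly.addPair_zero (hC : AuxCone C l c) {p : Set (Fin n → ℝ) × Set (Fin n → ℝ)}
    (hp : IsRelPoly C p) : _root_.addPair p (C, C) = p := by
  obtain ⟨p1, p2⟩ := p
  obtain ⟨⟨A, hA, h1⟩, ⟨B, hB, h2⟩, hb⟩ := hp
  simp only at h1 h2
  subst h1 h2
  simp only [_root_.addPair]
  rw [add_assoc, add_assoc, hC.add_self]

/-- The monoid of relative polyhedra. -/
@[reducible] noncomputable def auxMonoid (hC : AuxCone C l c) :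
    AddCommMonoid {p : Set (Fin n → ℝ) × Set (Fin n → ℝ) // IsRelPoly C p} where
  add p q := ⟨_root_.addPair p.1 q.1, p.2.addPair hC q.2⟩
  zero := ⟨(C, C), isRelPoly_zero hC⟩
  add_assoc p q r := Subtype.ext (Prod.ext (add_assoc _ _ _) (add_assoc _ _ _))
  add_comm p q := Subtype.ext (Prod.ext (add_comm _ _) (add_comm _ _))
  add_zero p := Subtype.ext (p.2.addPair_zero hC)
  zero_add p := Subtype.ext
    ((Prod.ext (add_comm _ _) (add_comm _ _) : _root_.addPair (C, C) p.1 = _root_.addPair p.1 (C, C)).trans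
      (p.2.addPair_zero hC))
  nsmul := @nsmulRec _ ⟨⟨(C, C), isRelPoly_zero hC⟩⟩
    ⟨fun p q => ⟨_root_.addPair p.1 q.1, p.2.addPair hC q.2⟩⟩
  nsmul_zero _ := rfl
  nsmul_succ _ _ := rfl

/-- A set of the form `P + C` with `P` compact convex and `l ≤ N` on `P`. -/
def AuxGood (C : Set (Fin n → ℝ)) (l : (Fin n → ℝ) →L[ℝ] ℝ) (X : Set (Fin n → ℝ)) (N : ℝ) : Prop :=
  ∃ P, IsCompact P ∧ Convex ℝ P ∧ P.Nonempty ∧ X = P + C ∧ ∀ x ∈ P, l x ≤ N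

/-- Truncation. -/
def auxTr (l : (Fin n → ℝ) →L[ℝ] ℝ) (X : Set (Fin n → ℝ)) (N : ℝ) : Set (Fin n → ℝ) :=
  X ∩ {x | l x ≤ N}

theorem AuxGood.add (hC : AuxCone C l c) {X Y : Set (Fin n → ℝ)} {N N' : ℝ}
    (hX : AuxGood C l X N) (hY : AuxGood C l Y N') : AuxGood C l (X + Y) (N + N') := by
  obtain ⟨P, h1, h2, h3, rfl, h4⟩ := hX
  obtain ⟨Q, h1', h2', h3', rfl, h4'⟩ := hY
  refine ⟨P + Q, h1.add h1', h2.add h2', h3.add h3', ?_, ?_⟩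
  · rw [add_add_add_comm, hC.add_self]
  · rintro _ ⟨a, ha, b, hb, rfl⟩
    simp only [map_add]
    exact add_le_add (h4 a ha) (h4' b hb)

theorem AuxGood.tr_add (hC : AuxCone C l c) {X Y : Set (Fin n → ℝ)} {N N' : ℝ}
    (hX : AuxGood C l X N) (hY : AuxGood C l Y N') :
    auxTr l X N + auxTr l Y N' = auxTr l (X + Y) (N + N') := by
  obtain ⟨P, h1, h2, h3, rfl, h4⟩ := hX
  obtain ⟨Q, h1', h2', h3', rfl, h4'⟩ := hY
  ext x
  constructor
  · rintro ⟨a, ha, b, hb, rfl⟩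
    refine ⟨⟨a, ha.1, b, hb.1, rfl⟩, ?_⟩
    have e1 : l a ≤ N := ha.2
    have e2 : l b ≤ N' := hb.2
    change l (a + b) ≤ N + N'
    rw [map_add]
    linarith
  · rintro ⟨⟨_, ⟨p, hp, c₁, hc₁, rfl⟩, _, ⟨q, hq, c₂, hc₂, rfl⟩, rfl⟩, hx⟩
    have hx' : l (p + c₁ + (q + c₂)) ≤ N + N' := hx
    have hd : c₁ + c₂ ∈ C := hC.add_mem _ hc₁ _ hc₂
    have hd0 := hC.l_nonneg _ hd
    simp only [map_add] at hx' hd0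
    have hp' := h4 p hp
    have hq' := h4' q hq
    obtain ⟨s, hs0, hs1, hsN, hsN'⟩ : ∃ s : ℝ, 0 ≤ s ∧ s ≤ 1 ∧
        l p + s * (l c₁ + l c₂) ≤ N ∧ l q + (1 - s) * (l c₁ + l c₂) ≤ N' := by
      by_cases h : l c₁ + l c₂ ≤ N - l p
      · exact ⟨1, by norm_num, le_rfl, by linarith, by linarith⟩
      · push Not at h
        have hpos : 0 < l c₁ + l c₂ := by linarith
        refine ⟨(N - l p) / (l c₁ + l c₂), div_nonneg (by linarith) hpos.le,
          (div_le_one hpos).2 h.le, ?_, ?_⟩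
        · rw [div_mul_cancel₀ _ hpos.ne']; linarith
        · rw [sub_mul, div_mul_cancel₀ _ hpos.ne']; linarith
    refine ⟨p + s • (c₁ + c₂), ⟨⟨p, hp, _, hC.smul_mem s hs0 _ hd, rfl⟩, ?_⟩,
      q + (1 - s) • (c₁ + c₂), ⟨⟨q, hq, _, hC.smul_mem (1 - s) (by linarith) _ hd, rfl⟩, ?_⟩, ?_⟩
    · change l _ ≤ N
      simpa [mul_add] using hsN
    · change l _ ≤ N'
      simpa [mul_add] using hsN'
    · simp only
      rw [sub_smul, one_smul]
      abel

theorem AuxGood.zero (hC : AuxCone C l c) : AuxGood C l C 0 :=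
  ⟨{0}, isCompact_singleton, convex_singleton _, Set.singleton_nonempty _, by simp, by simp⟩

theorem AuxCone.tr_zero (hC : AuxCone C l c) : auxTr l C 0 = 0 := by
  ext x
  constructor
  · rintro ⟨hx, h0⟩
    have h0' : l x ≤ 0 := h0
    have := hC.le x hx
    have hc := hC.c_pos
    have hn := norm_nonneg x
    have : ‖x‖ = 0 := by nlinarith
    simpa using this
  · intro hx
    have : x = 0 := by simpa using hx
    subst this
    exact ⟨hC.zero_mem, by simp⟩

theorem AuxGood.tr_compact (hC : AuxCone C l c) {X : Set (Fin n → ℝ)} {N : ℝ}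
    (hX : AuxGood C l X N) : IsCompact (auxTr l X N) := by
  obtain ⟨P, h1, h2, h3, rfl, h4⟩ := hX
  refine Metric.isCompact_of_isClosed_isBounded ?_ ?_
  · exact (hC.closed.add_left_of_isCompact h1).inter (isClosed_le l.continuous continuous_const)
  · obtain ⟨R, hR⟩ := isBounded_iff_forall_norm_le.1 h1.isBounded
    refine isBounded_iff_forall_norm_le.2 ⟨R + (N + ‖l‖ * R) / c, ?_⟩
    rintro _ ⟨⟨p, hp, d, hd, rfl⟩, hx⟩
    have hx' : l (p + d) ≤ N := hx
    rw [map_add] at hx'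
    have h5 := hC.le d hd
    have hp' := hR p hp
    have h6 : -(‖l‖ * R) ≤ l p := by
      have h7 := l.le_opNorm p
      have h8 : ‖l‖ * ‖p‖ ≤ ‖l‖ * R := by gcongr
      have h9 := neg_abs_le (l p)
      rw [Real.norm_eq_abs] at h7
      linarith
    have h10 : ‖d‖ ≤ (N + ‖l‖ * R) / c := by
      rw [le_div_iff₀ hC.c_pos]
      linarith
    exact (norm_add_le _ _).trans (add_le_add hp' h10)

theorem AuxGood.tr_convex (hC : AuxCone C l c) {X : Set (Fin n → ℝ)} {N : ℝ}
    (hX : AuxGood C l X N) : Convex ℝ (auxTr l X N) := by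
  obtain ⟨P, h1, h2, h3, rfl, h4⟩ := hX
  exact (h2.add hC.convex).inter (convex_halfSpace_le l.toLinearMap.isLinear N)

theorem AuxGood.tr_nonempty (hC : AuxCone C l c) {X : Set (Fin n → ℝ)} {N : ℝ}
    (hX : AuxGood C l X N) : (auxTr l X N).Nonempty := by
  obtain ⟨P, h1, h2, ⟨p, hp⟩, rfl, h4⟩ := hX
  exact ⟨p, ⟨p, hp, 0, hC.zero_mem, add_zero p⟩, h4 p hp⟩

theorem aux_relVol_tr (hC : AuxCone C l c) {p : Set (Fin n → ℝ) × Set (Fin n → ℝ)} {N : ℝ}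
    (h1 : AuxGood C l p.1 N) (h2 : AuxGood C l p.2 N)
    (h : ∀ x ∈ (p.1 \ p.2) ∪ (p.2 \ p.1), l x ≤ N) :
    relVol n p = n.factorial *
      ((volume (auxTr l p.1 N)).toReal - (volume (auxTr l p.2 N)).toReal) := by
  unfold relVol
  congr 1
  have e1 : p.1 \ p.2 = auxTr l p.1 N \ auxTr l p.2 N := by
    ext x
    constructor
    · intro hx
      exact ⟨⟨hx.1, h x (Or.inl hx)⟩, fun hx' => hx.2 hx'.1⟩
    · intro hx
      exact ⟨hx.1.1, fun hx' => hx.2 ⟨hx', hx.1.2⟩⟩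
  have e2 : p.2 \ p.1 = auxTr l p.2 N \ auxTr l p.1 N := by
    ext x
    constructor
    · intro hx
      exact ⟨⟨hx.1, h x (Or.inr hx)⟩, fun hx' => hx.2 hx'.1⟩
    · intro hx
      exact ⟨hx.1.1, fun hx' => hx.2 ⟨hx', hx.1.2⟩⟩
  have c1 := h1.tr_compact hC
  have c2 := h2.tr_compact hC
  rw [e1, e2]
  have m1 := measureReal_sdiff_add_inter (μ := volume) (s := auxTr l p.1 N) c2.measurableSet
    c1.measure_lt_top.ne
  have m2 := measureReal_sdiff_add_inter (μ := volume) (s := auxTr l p.2 N) c1.measurableSet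
    c2.measure_lt_top.ne
  rw [Set.inter_comm] at m2
  simp only [Measure.real] at m1 m2
  linarith

theorem IsRelPoly.good {p : Set (Fin n → ℝ) × Set (Fin n → ℝ)} (hp : IsRelPoly C p) :
    ∀ᶠ N in Filter.atTop, AuxGood C l p.1 N ∧ AuxGood C l p.2 N := by
  obtain ⟨⟨A, hA, h1⟩, ⟨B, hB, h2⟩, hb⟩ := hp
  obtain ⟨a, ha⟩ := hA.compact.bddAbove_image l.continuous.continuousOn
  obtain ⟨b, hb⟩ := hB.compact.bddAbove_image l.continuous.continuousOn
  filter_upwards [Filter.eventually_ge_atTop a, Filter.eventually_ge_atTop b] with N hNa hNb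
  exact ⟨⟨A, hA.compact, hA.convex, hA.nonempty, h1, fun x hx =>
      (ha (Set.mem_image_of_mem _ hx)).trans hNa⟩,
    ⟨B, hB.compact, hB.convex, hB.nonempty, h2, fun x hx =>
      (hb (Set.mem_image_of_mem _ hx)).trans hNb⟩⟩

theorem IsRelPoly.diff_le {p : Set (Fin n → ℝ) × Set (Fin n → ℝ)} (hp : IsRelPoly C p) :
    ∀ᶠ N in Filter.atTop, ∀ x ∈ (p.1 \ p.2) ∪ (p.2 \ p.1), l x ≤ N := by
  obtain ⟨R, hR⟩ := isBounded_iff_forall_norm_le.1 hp.2.2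
  filter_upwards [Filter.eventually_ge_atTop (‖l‖ * R)] with N hN x hx
  calc l x ≤ ‖l x‖ := Real.le_norm_self _
    _ ≤ ‖l‖ * ‖x‖ := l.le_opNorm x
    _ ≤ ‖l‖ * R := by gcongr; exact hR x hx
    _ ≤ N := hN

theorem aux_vanish_rel (hC : AuxCone C l c) {ι : Type*} [Fintype ι] [DecidableEq ι]
    (hι : n < Fintype.card ι)
    (w : ι → {p : Set (Fin n → ℝ) × Set (Fin n → ℝ) // IsRelPoly C p}) :
    letI := auxMonoid hC
    ∑ S : Finset ι, (-1 : ℝ) ^ S.card * relVol n (∑ i ∈ S, w i).1 = 0 := by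
  letI := auxMonoid hC
  have hev : ∀ᶠ N in Filter.atTop, (0 : ℝ) ≤ N ∧
      (∀ i, AuxGood C l (w i).1.1 N ∧ AuxGood C l (w i).1.2 N) ∧
      ∀ S : Finset ι, ∀ x ∈ ((∑ i ∈ S, w i).1.1 \ (∑ i ∈ S, w i).1.2) ∪
        ((∑ i ∈ S, w i).1.2 \ (∑ i ∈ S, w i).1.1), l x ≤ N :=
    (Filter.eventually_ge_atTop 0).and ((Filter.eventually_all.2 fun i => (w i).2.good).and
      (Filter.eventually_all.2 fun S => (∑ i ∈ S, w i).2.diff_le))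
  obtain ⟨N, hN0, hgood, hdiff⟩ := hev.exists
  have key : ∀ S : Finset ι,
      AuxGood C l (∑ i ∈ S, w i).1.1 (S.card * N) ∧ AuxGood C l (∑ i ∈ S, w i).1.2 (S.card * N) ∧
      ∑ i ∈ S, auxTr l (w i).1.1 N = auxTr l (∑ i ∈ S, w i).1.1 (S.card * N) ∧
      ∑ i ∈ S, auxTr l (w i).1.2 N = auxTr l (∑ i ∈ S, w i).1.2 (S.card * N) := by
    intro S
    induction S using Finset.induction_on with
    | empty =>
      simp only [Finset.sum_empty, Finset.card_empty, Nat.cast_zero, zero_mul]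
      exact ⟨AuxGood.zero hC, AuxGood.zero hC, hC.tr_zero.symm, hC.tr_zero.symm⟩
    | insert a s ha ih =>
      obtain ⟨g1, g2, t1, t2⟩ := ih
      simp only [Finset.sum_insert ha, Finset.card_insert_of_notMem ha]
      rw [t1, t2]
      have e : (((s.card + 1 : ℕ) : ℝ)) * N = N + s.card * N := by push_cast; ring
      rw [e]
      exact ⟨(hgood a).1.add hC g1, (hgood a).2.add hC g2, (hgood a).1.tr_add hC g1,
        (hgood a).2.tr_add hC g2⟩
  have hrel : ∀ S : Finset ι, relVol n (∑ i ∈ S, w i).1 = n.factorial *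
      ((volume (∑ i ∈ S, auxTr l (w i).1.1 N)).toReal -
        (volume (∑ i ∈ S, auxTr l (w i).1.2 N)).toReal) := by
    intro S
    obtain ⟨g1, g2, t1, t2⟩ := key S
    rw [t1, t2]
    refine aux_relVol_tr hC g1 g2 ?_
    rcases S.eq_empty_or_nonempty with rfl | hne
    · intro x hx
      have h0 : (∑ i ∈ (∅ : Finset ι), w i).1.1 = (∑ i ∈ (∅ : Finset ι), w i).1.2 := by
        simp only [Finset.sum_empty]
        rfl
      rw [h0] at hx
      simp at hx
    · intro x hx
      refine (hdiff S x hx).trans ?_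
      have : (1 : ℝ) ≤ S.card := by exact_mod_cast hne.card_pos
      nlinarith
  have v1 := aux_vanish_convex hι (fun i => auxTr l (w i).1.1 N)
    (fun i => (hgood i).1.tr_compact hC) (fun i => (hgood i).1.tr_convex hC)
    (fun i => (hgood i).1.tr_nonempty hC)
  have v2 := aux_vanish_convex hι (fun i => auxTr l (w i).1.2 N)
    (fun i => (hgood i).2.tr_compact hC) (fun i => (hgood i).2.tr_convex hC)
    (fun i => (hgood i).2.tr_nonempty hC)
  calc ∑ S : Finset ι, (-1 : ℝ) ^ S.card * relVol n (∑ i ∈ S, w i).1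
      = n.factorial * (∑ S : Finset ι, (-1 : ℝ) ^ S.card *
          (volume (∑ i ∈ S, auxTr l (w i).1.1 N)).toReal -
        ∑ S : Finset ι, (-1 : ℝ) ^ S.card *
          (volume (∑ i ∈ S, auxTr l (w i).1.2 N)).toReal) := by
        rw [← Finset.sum_sub_distrib, Finset.mul_sum]
        refine Finset.sum_congr rfl fun S _ => ?_
        rw [hrel S]
        ring
    _ = 0 := by rw [v1, v2]; simp

theorem aux_hom (hC : AuxCone C l c) (k : ℕ)
    (p : {p : Set (Fin n → ℝ) × Set (Fin n → ℝ) // IsRelPoly C p}) :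
    letI := auxMonoid hC
    relVol n (k • p).1 = (k : ℝ) ^ n * relVol n p.1 := by
  letI := auxMonoid hC
  have hconv1 : Convex ℝ p.1.1 := by
    obtain ⟨A, hA, h1⟩ := p.2.1
    rw [h1]
    exact hA.convex.add hC.convex
  have hconv2 : Convex ℝ p.1.2 := by
    obtain ⟨A, hA, h1⟩ := p.2.2.1
    rw [h1]
    exact hA.convex.add hC.convex
  rcases k with _ | k
  · have h0 : relVol n (0 • p).1 = 0 := by
      rw [zero_smul]
      change relVol n (C, C) = 0
      simp [relVol]
    rw [h0]
    rcases Nat.eq_zero_or_pos n with hn | hn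
    · have hu : ∀ s : Set (Fin n → ℝ), s.Nonempty → s = Set.univ := by
        subst hn
        intro s hs
        exact Subsingleton.eq_univ_of_nonempty hs
      have e1 : p.1.1 = Set.univ := hu _ (by
        obtain ⟨A, hA, h1⟩ := p.2.1
        rw [h1]
        exact hA.nonempty.add ⟨0, hC.zero_mem⟩)
      have e2 : p.1.2 = Set.univ := hu _ (by
        obtain ⟨A, hA, h1⟩ := p.2.2.1
        rw [h1]
        exact hA.nonempty.add ⟨0, hC.zero_mem⟩)
      simp [relVol, e1, e2]
    · simp [hn.ne']
  · have hk : ((k + 1) • p).1.1 = ((k + 1 : ℕ) : ℝ) • p.1.1 ∧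
        ((k + 1) • p).1.2 = ((k + 1 : ℕ) : ℝ) • p.1.2 := by
      induction k with
      | zero => simp
      | succ k ih =>
        have e : (k + 1 + 1) • p = (k + 1) • p + p := succ_nsmul p (k + 1)
        have hn : (0 : ℝ) ≤ ((k + 1 : ℕ) : ℝ) := Nat.cast_nonneg _
        rw [e]
        constructor
        · change ((k + 1) • p).1.1 + p.1.1 = _
          rw [ih.1, Nat.cast_succ (k + 1), hconv1.add_smul hn zero_le_one, one_smul]
        · change ((k + 1) • p).1.2 + p.1.2 = _
          rw [ih.2, Nat.cast_succ (k + 1), hconv2.add_smul hn zero_le_one, one_smul]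
    have hk0 : ((k + 1 : ℕ) : ℝ) ≠ 0 := by positivity
    unfold relVol
    rw [hk.1, hk.2, ← Set.smul_set_sdiff₀ hk0, ← Set.smul_set_sdiff₀ hk0,
      Measure.addHaar_smul, Measure.addHaar_smul, ENNReal.toReal_mul, ENNReal.toReal_mul,
      ENNReal.toReal_ofReal (abs_nonneg _), abs_of_nonneg (by positivity)]
    simp only [Module.finrank_fintype_fun_eq_card, Fintype.card_fin]
    ring

end

theorem stmt4 (n : ℕ) (C : Set (Fin n → ℝ))
    -- `C` is the polar cone of a pointed rational polyhedral cone: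
    (hCpoly : ∃ V : Finset (Fin n → ℚ),
      C = {x | ∀ v ∈ V, 0 ≤ ∑ i, (v i : ℝ) * x i})
    (hCpointed : ∀ x ∈ C, -x ∈ C → x = 0) :
    ∃ MV : (Fin n → Set (Fin n → ℝ) × Set (Fin n → ℝ)) → ℝ,
      IsMixedVolume n C MV ∧
      ∀ MV', IsMixedVolume n C MV' →
        ∀ v, (∀ j, IsRelPoly C (v j)) → MV' v = MV v := by
  classical
  obtain ⟨l, c, hC⟩ := auxCone_exists n C hCpoly hCpointed
  letI := auxMonoid hC
  set f : {p : Set (Fin n → ℝ) × Set (Fin n → ℝ) // IsRelPoly C p} → ℝ :=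
    fun p => relVol n p.1 with hf
  have hup : ∀ (v : Fin n → {p : Set (Fin n → ℝ) × Set (Fin n → ℝ) // IsRelPoly C p}) (i : Fin n)
      (x : {p : Set (Fin n → ℝ) × Set (Fin n → ℝ) // IsRelPoly C p}),
      (fun j => (Function.update v i x j).1) = Function.update (fun j => (v j).1) i x.1 := by
    intro v i x
    ext1 j
    by_cases h : j = i
    · subst h; simp
    · simp [Function.update_of_ne h]
  set MV : (Fin n → Set (Fin n → ℝ) × Set (Fin n → ℝ)) → ℝ := fun v =>
    if h : ∀ j, IsRelPoly C (v j) then auxPol n f (fun j => ⟨v j, h j⟩) else 0 with hMV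
  have hMVsub : ∀ v : Fin n → {p : Set (Fin n → ℝ) × Set (Fin n → ℝ) // IsRelPoly C p},
      MV (fun j => (v j).1) = auxPol n f v := by
    intro v
    have h : ∀ j, IsRelPoly C (v j).1 := fun j => (v j).2
    simp only [hMV]
    rw [dif_pos h]
  refine ⟨MV, ⟨?_, ?_, ?_⟩, ?_⟩
  · intro v σ
    by_cases h : ∀ j, IsRelPoly C (v j)
    · have h1 := hMVsub (fun j => ⟨v j, h j⟩)
      have h2 := hMVsub ((fun j => ⟨v j, h j⟩ :
        Fin n → {p : Set (Fin n → ℝ) × Set (Fin n → ℝ) // IsRelPoly C p}) ∘ σ)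
      rw [auxPol_symm] at h2
      exact h2.trans h1.symm
    · have h' : ¬ ∀ j, IsRelPoly C ((v ∘ σ) j) := by
        intro hh
        apply h
        intro j
        simpa using hh (σ.symm j)
      simp only [hMV]
      rw [dif_neg h, dif_neg h']
  · intro v i p q hv hp hq
    have h1 := auxPol_add n f (fun w => aux_vanish_rel hC (by simp) w) (fun j => ⟨v j, hv j⟩) i
      ⟨p, hp⟩ ⟨q, hq⟩
    rw [← hMVsub, ← hMVsub, ← hMVsub, hup, hup, hup] at h1
    exact h1
  · intro p hp
    have h1 := auxPol_diag n f (fun k p => aux_hom hC k p) ⟨p, hp⟩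
    rw [← hMVsub] at h1
    exact h1
  · rintro MV' ⟨hs, ha, hd⟩ v hv
    have hadd : ∀ (v : Fin n → {p : Set (Fin n → ℝ) × Set (Fin n → ℝ) // IsRelPoly C p}) (i : Fin n)
        (x y : {p : Set (Fin n → ℝ) × Set (Fin n → ℝ) // IsRelPoly C p}),
        MV' (fun j => (Function.update v i (x + y) j).1) =
          MV' (fun j => (Function.update v i x j).1) +
            MV' (fun j => (Function.update v i y j).1) := by
      intro v i x y
      rw [hup, hup, hup]
      exact ha _ i x.1 y.1 (fun j => (v j).2) x.2 y.2
    let T : MultilinearMap ℕ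
        (fun _ : Fin n => {p : Set (Fin n → ℝ) × Set (Fin n → ℝ) // IsRelPoly C p}) ℝ :=
      { toFun := fun v => MV' (fun j => (v j).1)
        map_update_add' := by
          intro inst v i x y
          rw [Subsingleton.elim inst (instDecidableEqFin n)]
          exact hadd v i x y
        map_update_smul' := by
          intro inst v i k x
          rw [Subsingleton.elim inst (instDecidableEqFin n)]
          induction k with
          | zero =>
            have := hadd v i 0 0
            rw [add_zero] at this
            rw [zero_smul, zero_smul]
            linarith
          | succ k ih =>
            rw [succ_nsmul, hadd, ih, succ_nsmul] }
    have h1 := auxPol_unique n f T (fun v σ => hs (fun j => (v j).1) σ)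
      (fun p => hd p.1 p.2) (fun j => ⟨v j, hv j⟩)
    rw [← hMVsub] at h1
    exact h1
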